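/- There is a computable function F : ℚ × ℚ × ℚ × ℚ × ℚ × ℚ × ℚ → Bool such that for all rationals a1, b1, a2, b2, c, x0, t: if the two-interval PAM f defined by these parameters maps [0,1) ∩ ℚ into [0,1) ∩ ℚ, is injective on [0,1) ∩ ℚ, at least one of a1, a2 is negative, and x0, t ∈ [0,1) ∩ ℚ, then F (a1, b1, a2, b2, c, x0, t) = true if and only if there exists n : ℕ with f^[n] x0 = t. (Reachability is decidable for injective two-interval PAM with at least one negative slope.) -/

import Mathlib

/-- The two-interval piecewise affine map on `[0,1) ∩ ℚ` given by rationals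
`a1, b1, a2, b2, c`. -/
def pam2 (a1 b1 a2 b2 c : ℚ) (x : ℚ) : ℚ :=
  if 0 ≤ x ∧ x < c then a1 * x + b1
  else if c ≤ x ∧ x < 1 then a2 * x + b2
  else 0

namespace PamAux
open Encodable Denumerable

theorem comp_find {α : Type*} [Primcodable α] (p : α → ℕ → Bool) (hp : Computable₂ p)
    (h : ∀ a, ∃ n, p a n = true) : Computable fun a => Nat.find (h a) := by
  refine Partrec.of_eq_tot (Partrec.rfind (p := fun a n => Part.some (p a n)) hp.partrec₂) ?_
  intro a
  refine Nat.mem_rfind.2 ⟨?_, ?_⟩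
  · simpa using (Nat.find_spec (h a))
  · intro m hm
    simpa using (Nat.find_min (h a) hm)

/-- The encoding underlying the denumerability of the rationals. -/
def oldEnc (q : ℚ) : ℕ := @encode ℚ Rat.instEncodable q

/-- Code of an integer. -/
def intCode (z : ℤ) : ℕ := Equiv.intEquivNat z

theorem oldEnc_eq (q : ℚ) : oldEnc q = Nat.pair (intCode q.num) q.den := by
  rfl

theorem intCode_nonneg (n : ℕ) : intCode (n : ℤ) = 2 * n := rfl
theorem intCode_neg (n : ℕ) : intCode (Int.negSucc n) = 2 * n + 1 := rfl

theorem oldEnc_ofNat :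
    ∃ (_ : DecidablePred (· ∈ Set.range oldEnc)) (_ : Infinite (Set.range oldEnc)),
    ∀ k, oldEnc (ofNat ℚ k) = (Nat.Subtype.ofNat (Set.range oldEnc) k : ℕ) := by
  let i1 := @decidableRangeEncode ℚ Rat.instEncodable
  let i2 : Infinite (Set.range (@encode ℚ Rat.instEncodable)) :=
    Infinite.of_injective _ (Equiv.ofInjective _ encode_injective).injective
  refine ⟨i1, i2, fun k => ?_⟩
  let i3 := Nat.Subtype.denumerable (Set.range (@encode ℚ Rat.instEncodable))
  have h1 : ofNat ℚ k = (@equivRangeEncode ℚ Rat.instEncodable).symm (ofNat (Set.range (@encode ℚ Rat.instEncodable)) k) :=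
    Denumerable.ofEquiv_ofNat (Set.range (@encode ℚ Rat.instEncodable)) (@equivRangeEncode ℚ Rat.instEncodable) k
  have h2 : ofNat (Set.range (@encode ℚ Rat.instEncodable)) k = Nat.Subtype.ofNat (Set.range (@encode ℚ Rat.instEncodable)) k :=
    rfl
  have h3 : ∀ y, oldEnc ((@equivRangeEncode ℚ Rat.instEncodable).symm y) = y.1 := by
    intro y
    exact congrArg Subtype.val ((@equivRangeEncode ℚ Rat.instEncodable).apply_symm_apply y)
  rw [h1, h3, h2]
  rfl

theorem oldEnc_zero_mem : ∃ q, oldEnc q = oldEnc (ofNat ℚ 0) := ⟨_, rfl⟩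

theorem oldEnc_succ (k m : ℕ) :
    (oldEnc (ofNat ℚ k) < m → m ∈ Set.range oldEnc → oldEnc (ofNat ℚ (k+1)) ≤ m) := by
  obtain ⟨i1, i2, h⟩ := oldEnc_ofNat
  rw [h, h]
  intro h1 h2
  exact Nat.Subtype.succ_le_of_lt (x := ⟨m, h2⟩) (y := Nat.Subtype.ofNat (Set.range oldEnc) k) h1

theorem oldEnc_lt_succ (k : ℕ) : oldEnc (ofNat ℚ k) < oldEnc (ofNat ℚ (k+1)) := by
  obtain ⟨i1, i2, h⟩ := oldEnc_ofNat
  rw [h, h]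
  exact Nat.Subtype.lt_succ_self (Nat.Subtype.ofNat (Set.range oldEnc) k)

/-- Recognizes the codes of rationals. -/
def isCode (n : ℕ) : Prop :=
  0 < n.unpair.2 ∧ Nat.Coprime ((n.unpair.1 + 1) / 2) n.unpair.2

theorem natAbs_intCode (z : ℤ) : z.natAbs = (intCode z + 1) / 2 := by
  cases z with
  | ofNat n => 
    have := intCode_nonneg n
    simp only [Int.ofNat_eq_natCast, this]
    simp; omega
  | negSucc n => rw [intCode_neg]; simp; omega

theorem mem_range_oldEnc (n : ℕ) : n ∈ Set.range oldEnc ↔ isCode n := by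
  constructor
  · rintro ⟨q, rfl⟩
    rw [oldEnc_eq, isCode, Nat.unpair_pair]
    simp only
    rw [← natAbs_intCode]
    exact ⟨q.pos, q.reduced⟩
  · rintro ⟨h1, h2⟩
    obtain ⟨z, hz⟩ := Equiv.intEquivNat.surjective n.unpair.1
    have hz' : intCode z = n.unpair.1 := hz
    rw [← hz', ← natAbs_intCode] at h2
    refine ⟨⟨z, n.unpair.2, h1.ne', h2⟩, ?_⟩
    rw [oldEnc_eq, hz']
    simp

theorem isCode_primrec : PrimrecPred isCode := by
  have hcop : PrimrecRel Nat.Coprime := by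
    have h1 : PrimrecRel fun (d : ℕ) (p : ℕ × ℕ) => ¬ (p.1 % d = 0 ∧ p.2 % d = 0 ∧ 2 ≤ d) := by
      refine PrimrecPred.not (PrimrecPred.and ?_ (PrimrecPred.and ?_ ?_))
      · exact PrimrecRel.comp Primrec.eq (Primrec.nat_mod.comp (Primrec.fst.comp Primrec.snd) Primrec.fst) (Primrec.const 0)
      · exact PrimrecRel.comp Primrec.eq (Primrec.nat_mod.comp (Primrec.snd.comp Primrec.snd) Primrec.fst) (Primrec.const 0)
      · exact PrimrecRel.comp Primrec.nat_le (Primrec.const 2) Primrec.fst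
    have h2 := PrimrecRel.forall_mem_list h1
    have h3 : PrimrecPred fun p : ℕ × ℕ => ∀ x < p.1 + p.2 + 3, ¬ (p.1 % x = 0 ∧ p.2 % x = 0 ∧ 2 ≤ x) :=
      PrimrecPred.of_eq (h2.comp (Primrec.list_range.comp (Primrec.nat_add.comp (Primrec.nat_add.comp Primrec.fst Primrec.snd) (Primrec.const 3))) Primrec.id)
        (fun p => by simp only [List.mem_range, id])
    refine PrimrecPred.of_eq h3 ?_
    rintro ⟨a, b⟩
    simp only
    constructor
    · intro h
      by_contra hc
      rw [Nat.Prime.not_coprime_iff_dvd] at hc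
      obtain ⟨p, hp, h1, h2⟩ := hc
      rcases Nat.eq_zero_or_pos a with ha | ha
      · rcases Nat.eq_zero_or_pos b with hb | hb
        · exact h 2 (by omega) (by simp [ha, hb])
        · exact h p (by have := Nat.le_of_dvd hb h2; omega) ⟨Nat.mod_eq_zero_of_dvd h1, Nat.mod_eq_zero_of_dvd h2, hp.two_le⟩
      · exact h p (by have := Nat.le_of_dvd ha h1; omega) ⟨Nat.mod_eq_zero_of_dvd h1, Nat.mod_eq_zero_of_dvd h2, hp.two_le⟩
    · rintro h x - ⟨h1, h2, h3⟩
      have := Nat.eq_one_of_dvd_coprimes h (Nat.dvd_of_mod_eq_zero h1) (Nat.dvd_of_mod_eq_zero h2)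
      omega
  refine PrimrecPred.and ?_ ?_
  · exact PrimrecRel.comp Primrec.nat_lt (Primrec.const 0) (Primrec.snd.comp Primrec.unpair)
  · exact PrimrecRel.comp hcop (Primrec.nat_div.comp (Primrec.succ.comp (Primrec.fst.comp Primrec.unpair)) (Primrec.const 2)) (Primrec.snd.comp Primrec.unpair)

instance : DecidablePred isCode := fun _ => inferInstanceAs (Decidable (_ ∧ _))

theorem oldEnc_ofNat_computable : Computable fun k : ℕ => oldEnc (ofNat ℚ k) := by
  have hc : Primrec fun n => decide (isCode n) := primrecPred_iff_primrec_decide.1 isCode_primrec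
  have hex : ∀ n : ℕ, ∃ m, (decide (n < m) && decide (isCode m)) = true := by
    intro n
    have hs : StrictMono fun k : ℕ => oldEnc (ofNat ℚ k) := strictMono_nat_of_lt_succ oldEnc_lt_succ
    refine ⟨oldEnc (ofNat ℚ (n+1)), ?_⟩
    have h1 := hs.id_le (n+1)
    have h2 := (mem_range_oldEnc _).1 ⟨ofNat ℚ (n+1), rfl⟩
    simp only [id] at h1
    simp only [Bool.and_eq_true, decide_eq_true_eq]
    exact ⟨by omega, h2⟩
  have hlt : Primrec₂ fun (n m : ℕ) => decide (n < m) :=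
    primrecRel_iff_primrec_decide.1 Primrec.nat_lt
  obtain ⟨nx, hnext, hspec, hmin⟩ : ∃ nx : ℕ → ℕ, Computable nx ∧ (∀ n, n < nx n ∧ isCode (nx n)) ∧
      ∀ n m, n < m → isCode m → nx n ≤ m := by
    refine ⟨fun n => Nat.find (hex n), ?_, ?_, ?_⟩
    · apply comp_find
      exact (Primrec.and.comp hlt (hc.comp Primrec.snd)).to_comp
    · intro n
      simpa using Nat.find_spec (hex n)
    · intro n m h1 h2
      apply Nat.find_min'
      simp [h1, h2]
  have := Computable.nat_rec (f := fun k : ℕ => k) (g := fun _ => oldEnc (ofNat ℚ 0))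
    (h := fun _ p => nx p.2) Computable.id (Computable.const _)
    (hnext.comp (Computable.snd.comp Computable.snd))
  refine this.of_eq ?_
  intro k
  induction k with
  | zero => rfl
  | succ k ih =>
    simp only at ih ⊢
    rw [ih]
    apply le_antisymm
    · exact hmin _ _ (oldEnc_lt_succ k) ((mem_range_oldEnc _).1 ⟨ofNat ℚ (k+1), rfl⟩)
    · exact oldEnc_succ _ _ (hspec _).1 ((mem_range_oldEnc _).2 (hspec _).2)

theorem oldEnc_computable : Computable oldEnc :=
  (oldEnc_ofNat_computable.comp Computable.encode).of_eq fun q => by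
    rw [Denumerable.ofNat_encode]

/-- Positive part of the numerator. -/
def rp (q : ℚ) : ℕ := q.num.toNat
/-- Negative part of the numerator. -/
def rm (q : ℚ) : ℕ := (-q.num).toNat

theorem den_computable : Computable Rat.den :=
  (Computable.snd.comp (Computable.unpair.comp oldEnc_computable)).of_eq fun q => by
    rw [oldEnc_eq, Nat.unpair_pair]

theorem intCode_parts (z : ℤ) : z.toNat = (if intCode z % 2 = 0 then intCode z / 2 else 0) ∧
    (-z).toNat = (if intCode z % 2 = 0 then 0 else (intCode z + 1) / 2) := by
  cases z with
  | ofNat n =>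
    have := intCode_nonneg n
    simp only [Int.ofNat_eq_natCast, this]
    simp
  | negSucc n =>
    rw [intCode_neg]
    constructor
    · rw [if_neg (by omega)]; rfl
    · rw [if_neg (by omega)]
      simp only [Int.neg_negSucc, Int.toNat_natCast]
      omega

theorem numCode_computable : Computable fun q : ℚ => intCode q.num :=
  (Computable.fst.comp (Computable.unpair.comp oldEnc_computable)).of_eq fun q => by
    rw [oldEnc_eq, Nat.unpair_pair]

theorem even_primrec : PrimrecPred fun n : ℕ => n % 2 = 0 :=
  PrimrecRel.comp Primrec.eq (Primrec.nat_mod.comp Primrec.id (Primrec.const 2)) (Primrec.const 0)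

theorem rp_computable : Computable rp := by
  have h : Primrec fun n : ℕ => if n % 2 = 0 then n / 2 else 0 :=
    Primrec.ite even_primrec (Primrec.nat_div.comp Primrec.id (Primrec.const 2)) (Primrec.const 0)
  exact (h.to_comp.comp numCode_computable).of_eq fun q => (intCode_parts q.num).1.symm

theorem rm_computable : Computable rm := by
  have h : Primrec fun n : ℕ => if n % 2 = 0 then 0 else (n + 1) / 2 :=
    Primrec.ite even_primrec (Primrec.const 0) (Primrec.nat_div.comp Primrec.succ (Primrec.const 2))
  exact (h.to_comp.comp numCode_computable).of_eq fun q => (intCode_parts q.num).2.symm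

theorem rat_parts (q : ℚ) : q = ((rp q : ℚ) - rm q) / q.den := by
  have h : ((rp q : ℤ) - rm q) = q.num := by
    unfold rp rm; omega
  have h' : ((rp q : ℚ) - rm q) = q.num := by exact_mod_cast h
  rw [h', Rat.num_div_den]

theorem nadd {α : Type*} [Primcodable α] {f g : α → ℕ} (hf : Computable f) (hg : Computable g) :
    Computable fun a => f a + g a := Primrec.nat_add.to_comp.comp hf hg
theorem nmul {α : Type*} [Primcodable α] {f g : α → ℕ} (hf : Computable f) (hg : Computable g) :
    Computable fun a => f a * g a := Primrec.nat_mul.to_comp.comp hf hg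
theorem nlt {α : Type*} [Primcodable α] {f g : α → ℕ} (hf : Computable f) (hg : Computable g) :
    Computable fun a => decide (f a < g a) :=
  (primrecRel_iff_primrec_decide.1 Primrec.nat_lt : Primrec₂ fun (n m : ℕ) => decide (n < m)).to_comp.comp hf hg
theorem neq {α : Type*} [Primcodable α] {f g : α → ℕ} (hf : Computable f) (hg : Computable g) :
    Computable fun a => decide (f a = g a) :=
  (primrecRel_iff_primrec_decide.1 Primrec.eq : Primrec₂ fun (n m : ℕ) => decide (n = m)).to_comp.comp hf hg

theorem qlt {α : Type*} [Primcodable α] {f g : α → ℚ} (hf : Computable f) (hg : Computable g) :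
    Computable fun a => decide (f a < g a) := by
  have h := nlt (nadd (nmul (rp_computable.comp hf) (den_computable.comp hg))
      (nmul (rm_computable.comp hg) (den_computable.comp hf)))
    (nadd (nmul (rp_computable.comp hg) (den_computable.comp hf))
      (nmul (rm_computable.comp hf) (den_computable.comp hg)))
  refine h.of_eq fun a => ?_
  rw [decide_eq_decide]
  conv_rhs => rw [rat_parts (f a), rat_parts (g a)]
  have h1 : (0 : ℚ) < (f a).den := by exact_mod_cast (f a).pos
  have h2 : (0 : ℚ) < (g a).den := by exact_mod_cast (g a).pos
  rw [div_lt_div_iff₀ h1 h2, ← Nat.cast_lt (α := ℚ)]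
  push_cast
  constructor <;> intro h <;> linarith

theorem qeq {α : Type*} [Primcodable α] {f g : α → ℚ} (hf : Computable f) (hg : Computable g) :
    Computable fun a => decide (f a = g a) :=
  ((Primrec.eq (α := ℚ)).decide.to_comp.comp hf hg)

/-- A function with a computable graph is computable. -/
theorem q_of_graph {α : Type*} [Primcodable α] {f : α → ℚ}
    (h : Computable₂ fun (a : α) (q : ℚ) => decide (f a = q)) : Computable f := by
  have h1 : Computable₂ fun (a : α) (k : ℕ) => decide (f a = ofNat ℚ k) :=
    h.comp Computable.fst ((Computable.ofNat ℚ).comp Computable.snd)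
  have h2 : ∀ a, ∃ k, decide (f a = ofNat ℚ k) = true := fun a =>
    let ⟨k, hk⟩ := (Denumerable.eqv ℚ).symm.surjective (f a)
    ⟨k, decide_eq_true hk.symm⟩
  refine ((Computable.ofNat ℚ).comp (comp_find _ h1 h2)).of_eq fun a => ?_
  have := Nat.find_spec (h2 a)
  rw [decide_eq_true_eq] at this
  exact this.symm

theorem qadd {α : Type*} [Primcodable α] {f g : α → ℚ} (hf : Computable f) (hg : Computable g) :
    Computable fun a => f a + g a := by
  apply q_of_graph
  have hf' : Computable fun p : α × ℚ => f p.1 := hf.comp Computable.fst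
  have hg' : Computable fun p : α × ℚ => g p.1 := hg.comp Computable.fst
  have hq : Computable fun p : α × ℚ => p.2 := Computable.snd
  have d1 := den_computable.comp hf'
  have d2 := den_computable.comp hg'
  have d3 := den_computable.comp hq
  have h := neq (nadd (nadd (nmul (nmul (rp_computable.comp hf') d2) d3)
      (nmul (nmul (rp_computable.comp hg') d1) d3)) (nmul (nmul (rm_computable.comp hq) d1) d2))
    (nadd (nadd (nmul (nmul (rm_computable.comp hf') d2) d3)
      (nmul (nmul (rm_computable.comp hg') d1) d3)) (nmul (nmul (rp_computable.comp hq) d1) d2))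
  refine h.of_eq ?_
  rintro ⟨a, q⟩
  rw [decide_eq_decide]
  conv_rhs => rw [rat_parts (f a), rat_parts (g a), rat_parts q]
  have h1 : (0 : ℚ) < (f a).den := by exact_mod_cast (f a).pos
  have h2 : (0 : ℚ) < (g a).den := by exact_mod_cast (g a).pos
  have h3 : (0 : ℚ) < q.den := by exact_mod_cast q.pos
  rw [div_add_div _ _ h1.ne' h2.ne', div_eq_div_iff (mul_pos h1 h2).ne' h3.ne',
    ← Nat.cast_inj (R := ℚ)]
  push_cast
  constructor <;> intro h <;> linarith

theorem qmul {α : Type*} [Primcodable α] {f g : α → ℚ} (hf : Computable f) (hg : Computable g) :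
    Computable fun a => f a * g a := by
  apply q_of_graph
  have hf' : Computable fun p : α × ℚ => f p.1 := hf.comp Computable.fst
  have hg' : Computable fun p : α × ℚ => g p.1 := hg.comp Computable.fst
  have hq : Computable fun p : α × ℚ => p.2 := Computable.snd
  have d1 := den_computable.comp hf'
  have d2 := den_computable.comp hg'
  have d3 := den_computable.comp hq
  have p1 := rp_computable.comp hf'
  have m1 := rm_computable.comp hf'
  have p2 := rp_computable.comp hg'
  have m2 := rm_computable.comp hg'
  have h := neq (nadd (nmul (nadd (nmul p1 p2) (nmul m1 m2)) d3)
      (nmul (nmul (rm_computable.comp hq) d1) d2))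
    (nadd (nmul (nadd (nmul p1 m2) (nmul m1 p2)) d3)
      (nmul (nmul (rp_computable.comp hq) d1) d2))
  refine h.of_eq ?_
  rintro ⟨a, q⟩
  rw [decide_eq_decide]
  conv_rhs => rw [rat_parts (f a), rat_parts (g a), rat_parts q]
  have h1 : (0 : ℚ) < (f a).den := by exact_mod_cast (f a).pos
  have h2 : (0 : ℚ) < (g a).den := by exact_mod_cast (g a).pos
  have h3 : (0 : ℚ) < q.den := by exact_mod_cast q.pos
  rw [div_mul_div_comm, div_eq_div_iff (mul_pos h1 h2).ne' h3.ne',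
    ← Nat.cast_inj (R := ℚ)]
  push_cast
  constructor <;> intro h <;> linarith

/-- Parameter tuples. -/
abbrev Q7 := ℚ × ℚ × ℚ × ℚ × ℚ × ℚ × ℚ

/-- Apply to `v` the affine branch selected by `u`. -/
def br (p : Q7) (u v : ℚ) : ℚ :=
  cond (decide (u < p.2.2.2.2.1)) (p.1 * v + p.2.1) (p.2.2.1 * v + p.2.2.2.1)

/-- `t` lies in the half-open segment from `u` (included) to `v` (excluded unless `u = v`). -/
def inSeg (t u v : ℚ) : Bool :=
  decide (t = u) || ((decide (u < t) && decide (t < v)) || (decide (v < t) && decide (t < u)))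

/-- `v` lies on the closed side of the breakpoint of `u`. -/
def okc (p : Q7) (u v : ℚ) : Bool :=
  cond (decide (u < p.2.2.2.2.1)) (!decide (p.2.2.2.2.1 < v)) (!decide (v < p.2.2.2.2.1))

/-- One step of the verifier. -/
def stp (p : Q7) (s : ℚ × ℚ × Bool) : ℚ × ℚ × Bool :=
  (br p s.1 s.1, br p s.1 s.2.1,
    s.2.2 && (okc p s.1 s.2.1 && !inSeg p.2.2.2.2.2.2 s.1 s.2.1))

/-- Iterated verifier. -/
def runv (p : Q7) (s : ℚ × ℚ × Bool) : ℕ → ℚ × ℚ × Bool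
  | 0 => s
  | n + 1 => stp p (runv p s n)

/-- The initial state. -/
def ini (p : Q7) : ℚ × ℚ × Bool := (p.2.2.2.2.2.1, p.2.2.2.2.2.1, true)

def reachC (p : Q7) (n : ℕ) : Bool := decide ((runv p (ini p) n).1 = p.2.2.2.2.2.2)

def mid (p : Q7) (n : ℕ) (q : ℚ) : ℚ × ℚ × Bool :=
  ((runv p (ini p) n).1, q, (runv p (ini p) n).2.2)

def nonreachC (p : Q7) (n m : ℕ) (q : ℚ) : Bool :=
  (runv p (mid p n q) (m + 1)).2.2 && (decide ((runv p (mid p n q) (m + 1)).2.1 = q) &&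
    inSeg (runv p (mid p n q) (m + 1)).1 (runv p (ini p) n).1 q)

def inI (x : ℚ) : Bool := !decide (x < 0) && decide (x < 1)

def goodC (p : Q7) (x y : ℚ) : Bool :=
  (decide (0 < p.2.2.2.2.1) && decide (p.2.2.2.2.1 < 1)) &&
  ((decide (p.1 < 0) || decide (p.2.2.1 < 0)) &&
  ((inI p.2.2.2.2.2.1 && inI p.2.2.2.2.2.2) &&
  ((!inI x || inI (br p x x)) &&
   (!inI x || (!inI y || (decide (x = y) || !decide (br p x x = br p y y)))))))

section
variable {α : Type*} [Primcodable α]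

theorem cand {f g : α → Bool} (hf : Computable f) (hg : Computable g) :
    Computable fun a => f a && g a := Primrec.and.to_comp.comp hf hg
theorem cor {f g : α → Bool} (hf : Computable f) (hg : Computable g) :
    Computable fun a => f a || g a := Primrec.or.to_comp.comp hf hg
theorem cnot {f : α → Bool} (hf : Computable f) :
    Computable fun a => !f a := Primrec.not.to_comp.comp hf

variable {p : α → Q7} {u v t x y : α → ℚ}

theorem c1 (hp : Computable p) : Computable fun a => (p a).1 := Computable.fst.comp hp
theorem c2 (hp : Computable p) : Computable fun a => (p a).2.1 :=
  Computable.fst.comp (Computable.snd.comp hp)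
theorem c3 (hp : Computable p) : Computable fun a => (p a).2.2.1 :=
  Computable.fst.comp (Computable.snd.comp (Computable.snd.comp hp))
theorem c4 (hp : Computable p) : Computable fun a => (p a).2.2.2.1 :=
  Computable.fst.comp (Computable.snd.comp (Computable.snd.comp (Computable.snd.comp hp)))
theorem c5 (hp : Computable p) : Computable fun a => (p a).2.2.2.2.1 :=
  Computable.fst.comp (Computable.snd.comp (Computable.snd.comp (Computable.snd.comp
    (Computable.snd.comp hp))))
theorem c6 (hp : Computable p) : Computable fun a => (p a).2.2.2.2.2.1 :=
  Computable.fst.comp (Computable.snd.comp (Computable.snd.comp (Computable.snd.comp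
    (Computable.snd.comp (Computable.snd.comp hp)))))
theorem c7 (hp : Computable p) : Computable fun a => (p a).2.2.2.2.2.2 :=
  Computable.snd.comp (Computable.snd.comp (Computable.snd.comp (Computable.snd.comp
    (Computable.snd.comp (Computable.snd.comp hp)))))

theorem cbr (hp : Computable p) (hu : Computable u) (hv : Computable v) :
    Computable fun a => br (p a) (u a) (v a) :=
  Computable.cond (qlt hu (c5 hp)) (qadd (qmul (c1 hp) hv) (c2 hp)) (qadd (qmul (c3 hp) hv) (c4 hp))

theorem cseg (ht : Computable t) (hu : Computable u) (hv : Computable v) :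
    Computable fun a => inSeg (t a) (u a) (v a) :=
  cor (qeq ht hu) (cor (cand (qlt hu ht) (qlt ht hv)) (cand (qlt hv ht) (qlt ht hu)))

theorem cokc (hp : Computable p) (hu : Computable u) (hv : Computable v) :
    Computable fun a => okc (p a) (u a) (v a) :=
  Computable.cond (qlt hu (c5 hp)) (cnot (qlt (c5 hp) hv)) (cnot (qlt hv (c5 hp)))

theorem cstp {s : α → ℚ × ℚ × Bool} (hp : Computable p) (hs : Computable s) :
    Computable fun a => stp (p a) (s a) := by
  have h1 : Computable fun a => (s a).1 := Computable.fst.comp hs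
  have h2 : Computable fun a => (s a).2.1 := Computable.fst.comp (Computable.snd.comp hs)
  have h3 : Computable fun a => (s a).2.2 := Computable.snd.comp (Computable.snd.comp hs)
  exact (cbr hp h1 h1).pair ((cbr hp h1 h2).pair
    (cand h3 (cand (cokc hp h1 h2) (cnot (cseg (c7 hp) h1 h2)))))

theorem crunv {s : α → ℚ × ℚ × Bool} {n : α → ℕ} (hp : Computable p) (hs : Computable s)
    (hn : Computable n) : Computable fun a => runv (p a) (s a) (n a) := by
  have h : Computable₂ fun (a : α) (q : ℕ × (ℚ × ℚ × Bool)) => stp (p a) q.2 :=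
    cstp (p := fun z : α × ℕ × (ℚ × ℚ × Bool) => p z.1) (hp.comp Computable.fst)
      (Computable.snd.comp Computable.snd)
  refine (Computable.nat_rec hn hs h).of_eq fun a => ?_
  induction n a with
  | zero => rfl
  | succ k ih => simp only at ih ⊢; rw [ih]; rfl

theorem cini (hp : Computable p) : Computable fun a => ini (p a) :=
  (c6 hp).pair ((c6 hp).pair (Computable.const true))

theorem creach {n : α → ℕ} (hp : Computable p) (hn : Computable n) :
    Computable fun a => reachC (p a) (n a) :=
  qeq (Computable.fst.comp (crunv hp (cini hp) hn)) (c7 hp)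

theorem cnonreach {n m : α → ℕ} {q : α → ℚ} (hp : Computable p) (hn : Computable n)
    (hm : Computable m) (hq : Computable q) :
    Computable fun a => nonreachC (p a) (n a) (m a) (q a) := by
  have h1 := crunv hp (cini hp) hn
  have h2 : Computable fun a => mid (p a) (n a) (q a) :=
    (Computable.fst.comp h1).pair (hq.pair (Computable.snd.comp (Computable.snd.comp h1)))
  have h3 := crunv hp h2 (Computable.succ.comp hm)
  exact cand (Computable.snd.comp (Computable.snd.comp h3))
    (cand (qeq (Computable.fst.comp (Computable.snd.comp h3)) hq)
      (cseg (Computable.fst.comp h3) (Computable.fst.comp h1) hq))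

theorem cinI (hx : Computable x) : Computable fun a => inI (x a) :=
  cand (cnot (qlt hx (Computable.const 0))) (qlt hx (Computable.const 1))

theorem cgood (hp : Computable p) (hx : Computable x) (hy : Computable y) :
    Computable fun a => goodC (p a) (x a) (y a) :=
  cand (cand (qlt (Computable.const 0) (c5 hp)) (qlt (c5 hp) (Computable.const 1)))
    (cand (cor (qlt (c1 hp) (Computable.const 0)) (qlt (c3 hp) (Computable.const 0)))
    (cand (cand (cinI (c6 hp)) (cinI (c7 hp)))
    (cand (cor (cnot (cinI hx)) (cinI (cbr hp hx hx)))
      (cor (cnot (cinI hx)) (cor (cnot (cinI hy))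
        (cor (qeq hx hy) (cnot (qeq (cbr hp hx hx) (cbr hp hy hy)))))))))
end

/-- The full certificate check. -/
def certC (p : Q7) (w : ℕ × ℕ × ℚ × ℚ × ℚ) : Bool :=
  !goodC p w.2.2.2.1 w.2.2.2.2 || (reachC p w.1 || nonreachC p w.1 w.2.1 w.2.2.1)

theorem ccert : Computable₂ certC := by
  have hp : Computable fun z : Q7 × (ℕ × ℕ × ℚ × ℚ × ℚ) => z.1 := Computable.fst
  have h0 : Computable fun z : Q7 × (ℕ × ℕ × ℚ × ℚ × ℚ) => z.2 := Computable.snd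
  have h1 : Computable fun z : Q7 × (ℕ × ℕ × ℚ × ℚ × ℚ) => z.2.1 := Computable.fst.comp h0
  have h2' : Computable fun z : Q7 × (ℕ × ℕ × ℚ × ℚ × ℚ) => z.2.2 := Computable.snd.comp h0
  have h2 : Computable fun z : Q7 × (ℕ × ℕ × ℚ × ℚ × ℚ) => z.2.2.1 := Computable.fst.comp h2'
  have h3' : Computable fun z : Q7 × (ℕ × ℕ × ℚ × ℚ × ℚ) => z.2.2.2 := Computable.snd.comp h2'
  have h3 : Computable fun z : Q7 × (ℕ × ℕ × ℚ × ℚ × ℚ) => z.2.2.2.1 := Computable.fst.comp h3'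
  have h4' : Computable fun z : Q7 × (ℕ × ℕ × ℚ × ℚ × ℚ) => z.2.2.2.2 := Computable.snd.comp h3'
  have h4 : Computable fun z : Q7 × (ℕ × ℕ × ℚ × ℚ × ℚ) => z.2.2.2.2.1 := Computable.fst.comp h4'
  have h5 : Computable fun z : Q7 × (ℕ × ℕ × ℚ × ℚ × ℚ) => z.2.2.2.2.2 := Computable.snd.comp h4'
  exact cor (cnot (cgood hp h4 h5)) (cor (creach hp h1) (cnonreach hp h1 h2 h3))

/-- Decoding of certificates. -/
def decW (k : ℕ) : ℕ × ℕ × ℚ × ℚ × ℚ :=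
  (k.unpair.1, k.unpair.2.unpair.1, ofNat ℚ k.unpair.2.unpair.2.unpair.1,
    ofNat ℚ k.unpair.2.unpair.2.unpair.2.unpair.1, ofNat ℚ k.unpair.2.unpair.2.unpair.2.unpair.2)

theorem decW_computable : Computable decW := by
  have h1 : Computable fun k : ℕ => k.unpair.2 := Computable.snd.comp Computable.unpair
  have h2 : Computable fun k : ℕ => k.unpair.1 := Computable.fst.comp Computable.unpair
  have hq := Computable.ofNat ℚ
  exact h2.pair ((h2.comp h1).pair ((hq.comp (h2.comp (h1.comp h1))).pair
    ((hq.comp (h2.comp (h1.comp (h1.comp h1)))).pair (hq.comp (h1.comp (h1.comp (h1.comp h1)))))))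

theorem decW_surjective (w : ℕ × ℕ × ℚ × ℚ × ℚ) : ∃ k, decW k = w := by
  obtain ⟨n, m, a, b, c⟩ := w
  obtain ⟨ka, ha⟩ := (Denumerable.eqv ℚ).symm.surjective a
  obtain ⟨kb, hb⟩ := (Denumerable.eqv ℚ).symm.surjective b
  obtain ⟨kc, hc⟩ := (Denumerable.eqv ℚ).symm.surjective c
  replace ha : ofNat ℚ ka = a := ha
  replace hb : ofNat ℚ kb = b := hb
  replace hc : ofNat ℚ kc = c := hc
  refine ⟨Nat.pair n (Nat.pair m (Nat.pair ka (Nat.pair kb kc))), ?_⟩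
  simp only [decW, Nat.unpair_pair]
  rw [ha, hb, hc]

/-- From total certificates to a computable decision procedure. -/
theorem exists_decider (h : ∀ p, ∃ w, certC p w = true) :
    ∃ F : Q7 → Bool, Computable F ∧ ∀ p, ∃ w, certC p w = true ∧ F p = reachC p w.1 := by
  have hex : ∀ p, ∃ k, certC p (decW k) = true := by
    intro p
    obtain ⟨w, hw⟩ := h p
    obtain ⟨k, hk⟩ := decW_surjective w
    exact ⟨k, by rw [hk]; exact hw⟩
  have hc : Computable₂ fun (p : Q7) (k : ℕ) => certC p (decW k) :=
    ccert.comp Computable.fst (decW_computable.comp Computable.snd)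
  have hfind := comp_find _ hc hex
  refine ⟨fun p => reachC p (decW (Nat.find (hex p))).1, ?_, fun p => ⟨_, Nat.find_spec (hex p), rfl⟩⟩
  exact creach Computable.id (Computable.fst.comp (decW_computable.comp hfind))

theorem inSeg_iff (t u v : ℚ) : inSeg t u v = true ↔ t = u ∨ (u < t ∧ t < v) ∨ (v < t ∧ t < u) := by
  simp [inSeg]

theorem okc_iff (p : Q7) (u v : ℚ) : okc p u v = true ↔
    (u < p.2.2.2.2.1 → v ≤ p.2.2.2.2.1) ∧ (p.2.2.2.2.1 ≤ u → p.2.2.2.2.1 ≤ v) := by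
  unfold okc
  by_cases h : u < p.2.2.2.2.1
  · simp [h]
  · simp [h, not_lt.1 h]

theorem br_lt {p : Q7} {u v : ℚ} (h : u < p.2.2.2.2.1) : br p u v = p.1 * v + p.2.1 := by
  simp [br, h]
theorem br_ge {p : Q7} {u v : ℚ} (h : p.2.2.2.2.1 ≤ u) : br p u v = p.2.2.1 * v + p.2.2.2.1 := by
  simp [br, not_lt.2 h]

theorem affine_seg {z u v : ℚ} (a b : ℚ) (h : inSeg z u v = true) :
    inSeg (a * z + b) (a * u + b) (a * v + b) = true := by
  rw [inSeg_iff] at *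
  rcases lt_trichotomy a 0 with ha | ha | ha
  · rcases h with h | h | h
    · left; rw [h]
    · right; right; constructor <;> nlinarith
    · right; left; constructor <;> nlinarith
  · left; rw [ha]; ring
  · rcases h with h | h | h
    · left; rw [h]
    · right; left; constructor <;> nlinarith
    · right; right; constructor <;> nlinarith

theorem seg_step {p : Q7} {z u v : ℚ} (h : inSeg z u v = true) (hok : okc p u v = true) :
    inSeg (br p z z) (br p u u) (br p u v) = true := by
  have h' := (inSeg_iff _ _ _).1 h
  rw [okc_iff] at hok
  by_cases hu : u < p.2.2.2.2.1
  · have hv := hok.1 hu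
    have hz : z < p.2.2.2.2.1 := by
      rcases h' with h' | ⟨h1, h2⟩ | ⟨h1, h2⟩ <;> linarith
    rw [br_lt hz, br_lt hu, br_lt hu]
    exact affine_seg _ _ h
  · have hu := not_lt.1 hu
    have hv := hok.2 hu
    have hz : p.2.2.2.2.1 ≤ z := by
      rcases h' with h' | ⟨h1, h2⟩ | ⟨h1, h2⟩ <;> linarith
    rw [br_ge hz, br_ge hu, br_ge hu]
    exact affine_seg _ _ h

/-- The simplified map. -/
def fm (p : Q7) (x : ℚ) : ℚ := br p x x

theorem runv_sound (p : Q7) (s : ℚ × ℚ × Bool) (n : ℕ) (h : (runv p s n).2.2 = true) :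
    s.2.2 = true ∧ ∀ z, inSeg z s.1 s.2.1 = true →
      (∀ k < n, (fm p)^[k] z ≠ p.2.2.2.2.2.2) ∧
      inSeg ((fm p)^[n] z) (runv p s n).1 (runv p s n).2.1 = true := by
  induction n with
  | zero =>
    refine ⟨h, fun z hz => ⟨by simp, hz⟩⟩
  | succ n ih =>
    simp only [runv, stp, Bool.and_eq_true, Bool.not_eq_true'] at h
    obtain ⟨h1, h2, h3⟩ := h
    obtain ⟨h4, h5⟩ := ih h1
    refine ⟨h4, fun z hz => ?_⟩
    obtain ⟨h6, h7⟩ := h5 z hz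
    constructor
    · intro k hk
      rcases Nat.lt_succ_iff_lt_or_eq.1 hk with hk | rfl
      · exact h6 k hk
      · intro he
        rw [he, h3] at h7
        exact absurd h7 (by simp)
    · rw [Function.iterate_succ_apply']
      exact seg_step h7 h2

theorem runv_fst (p : Q7) (s : ℚ × ℚ × Bool) (n : ℕ) : (runv p s n).1 = (fm p)^[n] s.1 := by
  induction n with
  | zero => rfl
  | succ n ih => rw [Function.iterate_succ_apply', ← ih]; rfl

theorem reachC_iff (p : Q7) (n : ℕ) :
    reachC p n = true ↔ (fm p)^[n] p.2.2.2.2.2.1 = p.2.2.2.2.2.2 := by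
  rw [reachC, decide_eq_true_eq, runv_fst]; rfl

theorem nonreachC_sound (p : Q7) (n m : ℕ) (q : ℚ) (h : nonreachC p n m q = true) (k : ℕ) :
    (fm p)^[k] p.2.2.2.2.2.1 ≠ p.2.2.2.2.2.2 := by
  simp only [nonreachC, Bool.and_eq_true, decide_eq_true_eq] at h
  obtain ⟨h1, h2, h3⟩ := h
  obtain ⟨h4, h5⟩ := runv_sound _ _ _ h1
  obtain ⟨h6, h7⟩ := runv_sound p (ini p) n h4
  have h8 := (h7 p.2.2.2.2.2.1 (by simp [ini, inSeg])).1
  rcases lt_or_ge k n with hk | hk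
  · exact h8 k hk
  obtain ⟨j, rfl⟩ := Nat.exists_eq_add_of_le' hk
  rw [Function.iterate_add_apply]
  have key : ∀ j z, inSeg z (mid p n q).1 (mid p n q).2.1 = true → (fm p)^[j] z ≠ p.2.2.2.2.2.2 := by
    intro j
    induction j using Nat.strong_induction_on with
    | _ j ih =>
      intro z hz
      obtain ⟨h9, h10⟩ := h5 z hz
      rcases lt_or_ge j (m+1) with hj | hj
      · exact h9 j hj
      · obtain ⟨i, rfl⟩ := Nat.exists_eq_add_of_le' hj
        rw [Function.iterate_add_apply]
        apply ih i (by omega)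
        rw [h2] at h10
        have h3' := (inSeg_iff _ _ _).1 h3
        have h10' := (inSeg_iff _ _ _).1 h10
        refine (inSeg_iff _ _ _).2 ?_
        show _ = (runv p (ini p) n).1 ∨ ((runv p (ini p) n).1 < _ ∧ _ < q) ∨ (q < _ ∧ _ < (runv p (ini p) n).1)
        generalize (fm p)^[m+1] z = Z at *
        generalize (runv p (mid p n q) (m+1)).1 = Y at *
        rcases h3' with rfl | h3' | h3'
        · exact h10'
        · rcases h10' with rfl | h | h
          · right; left; exact h3'
          · right; left; constructor <;> linarith [h.1, h.2, h3'.1, h3'.2]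
          · exfalso; linarith [h.1, h.2, h3'.1, h3'.2]
        · rcases h10' with rfl | h | h
          · right; right; exact h3'
          · exfalso; linarith [h.1, h.2, h3'.1, h3'.2]
          · right; right; constructor <;> linarith [h.1, h.2, h3'.1, h3'.2]
  apply key
  simp [mid, runv_fst, ini, inSeg]

theorem seq_evper {α : Type*} [LinearOrder α] (x : ℕ → α) (P : ℕ → Prop)
    (h1 : ∀ i j, P i → ¬P j → x i < x j)
    (h2 : ∀ i j, P i → P j → x i ≤ x j → x (j+1) ≤ x (i+1))
    (h3 : ∀ i j, ¬P i → ¬P j → x i ≤ x j → x (i+1) ≤ x (j+1))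
    (h4 : ∀ i j, P i → ¬P j → x (j+1) < x (i+1)) :
    ∃ N M, 0 < M ∧ ∀ k, N ≤ k → (P (k+M) ↔ P k) := by
  classical
  by_cases hinf : ∀ n, ∃ j, P (n+j)
  swap
  · push Not at hinf
    obtain ⟨n, hn⟩ := hinf
    refine ⟨n, 1, one_pos, fun k hk => ?_⟩
    obtain ⟨j, rfl⟩ := Nat.exists_eq_add_of_le hk
    exact iff_of_false (hn (j+1)) (hn j)
  obtain ⟨τ, hτ, hmin⟩ : ∃ τ : ℕ → ℕ, (∀ n, P (n + τ n)) ∧ ∀ n j, j < τ n → ¬P (n+j) :=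
    ⟨fun n => Nat.find (hinf n), fun n => Nat.find_spec (hinf n), fun n j hj => Nat.find_min (hinf n) hj⟩
  have τ0 : ∀ n, P n → τ n = 0 := by
    intro n hn
    by_contra h
    exact hmin n 0 (by omega) hn
  have τ0' : ∀ n, τ n = 0 → P n := by
    intro n hn
    have := hτ n
    rwa [hn] at this
  have τs : ∀ n, ¬P n → τ n = τ (n+1) + 1 := by
    intro n hn
    have hne : τ n ≠ 0 := fun h => hn (τ0' n h)
    apply le_antisymm
    · by_contra hlt
      refine hmin n (τ (n+1) + 1) (by omega) ?_
      have := hτ (n+1)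
      rwa [show n + (τ (n+1) + 1) = n + 1 + τ (n+1) by ring]
    · by_contra hlt
      refine hmin (n+1) (τ n - 1) (by omega) ?_
      have := hτ n
      rwa [show n + 1 + (τ n - 1) = n + τ n by omega]
  have mono : ∀ d i j, τ j = d → x i ≤ x j → τ i ≤ d := by
    intro d
    induction d with
    | zero =>
      intro i j hj hx
      have hPj := τ0' j hj
      have hPi : P i := by
        by_contra h
        exact absurd (h1 j i hPj h) (not_lt.2 hx)
      rw [τ0 i hPi]
    | succ d ih =>
      intro i j hj hx
      have hPj : ¬P j := fun h => by rw [τ0 j h] at hj; omega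
      by_cases hPi : P i
      · rw [τ0 i hPi]; omega
      · have e1 := τs i hPi
        have e2 := τs j hPj
        have := ih (i+1) (j+1) (by omega) (h3 i j hPi hPj hx)
        omega
  have bound : ∀ i j, P i → P j → τ (j+1) ≤ τ (i+1) + 1 := by
    intro i j hi hj
    by_cases h : P (j+1)
    · rw [τ0 _ h]; omega
    · have e := τs _ h
      have := mono _ (j+1+1) (i+1) rfl (h4 i (j+1) hi h).le
      omega
  have hex : ∃ k i, P i ∧ τ (i+1) = k := by
    obtain ⟨j, hj⟩ := hinf 0
    exact ⟨_, _, hj, rfl⟩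
  obtain ⟨k, ⟨ik, hik, hTk⟩, hkmin⟩ : ∃ k, (∃ i, P i ∧ τ (i+1) = k) ∧ ∀ i, P i → k ≤ τ (i+1) :=
    ⟨Nat.find hex, Nat.find_spec hex, fun i hi => Nat.find_min' hex ⟨i, hi, rfl⟩⟩
  have hT : ∀ i, P i → τ (i+1) = k ∨ τ (i+1) = k + 1 := by
    intro i hi
    have := hkmin i hi
    have := bound ik i hik hi
    omega
  have xle : ∀ d i j, τ i = d → τ j = d → x i ≤ x j → x (i+d) ≤ x (j+d) := by
    intro d
    induction d with
    | zero => intro i j _ _ h; exact h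
    | succ d ih =>
      intro i j hi hj hx
      have hPi : ¬P i := fun h => by rw [τ0 i h] at hi; omega
      have hPj : ¬P j := fun h => by rw [τ0 j h] at hj; omega
      have e1 := τs i hPi
      have e2 := τs j hPj
      have := ih (i+1) (j+1) (by omega) (by omega) (h3 i j hPi hPj hx)
      rwa [show i + (d+1) = i + 1 + d by ring, show j + (d+1) = j + 1 + d by ring]
  have hA : ∀ i j, P i → P j → τ (i+1) = k + 1 → τ (j+1) = k → x i < x j := by
    intro i j hi hj hi' hj'
    by_contra h
    have := mono k (i+1) (j+1) hj' (h2 j i hj hi (not_lt.1 h))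
    omega
  have hB : ∀ i j, P i → P j → τ (i+1) = k + 1 → τ (j+1) = k →
      x (i+1+τ (i+1)) ≤ x (j+1+τ (j+1)) := by
    intro i j hi hj hi' hj'
    have hPi : ¬P (i+1) := fun h => by rw [τ0 _ h] at hi'; omega
    have e1 := τs _ hPi
    have := xle k (i+1+1) (j+1) (by omega) hj' (h4 j (i+1) hj hPi).le
    rw [hi', hj']
    rwa [show i + 1 + (k+1) = i + 1 + 1 + k by ring]
  have hdich : ∃ κ, (κ = k ∨ κ = k+1) ∧ ∀ i, P i → τ (i+1) = κ → τ (i+1+τ (i+1)+1) = κ := by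
    by_cases hL : ∀ i, P i → τ (i+1) = k+1 → τ (i+1+τ (i+1)+1) = k+1
    · exact ⟨k+1, Or.inr rfl, hL⟩
    · push Not at hL
      obtain ⟨i0, hi0, hi1, hi2⟩ := hL
      refine ⟨k, Or.inl rfl, fun j hj hj1 => ?_⟩
      by_contra hne
      have e1 := (hT _ (hτ (i0+1))).resolve_right hi2
      have e2 := (hT _ (hτ (j+1))).resolve_left hne
      have := hA _ _ (hτ (j+1)) (hτ (i0+1)) e2 e1
      exact absurd (hB i0 j hi0 hj hi1 hj1) (not_le.2 this)
  obtain ⟨κ, i0, hi0, hTi0, hcl⟩ : ∃ κ i0, P i0 ∧ τ (i0+1) = κ ∧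
      ∀ i, P i → τ (i+1) = κ → τ (i+1+τ (i+1)+1) = κ := by
    obtain ⟨κ, hκ, hcl⟩ := hdich
    by_cases hv : ∃ i, P i ∧ τ (i+1) = κ
    · obtain ⟨i, hi, hi'⟩ := hv
      exact ⟨κ, i, hi, hi', hcl⟩
    · push Not at hv
      obtain rfl : κ = k + 1 := by
        rcases hκ with rfl | h
        · exact absurd hTk (hv ik hik)
        · exact h
      exact ⟨k, ik, hik, hTk, fun i hi hi' => (hT _ (hτ (i+1))).resolve_right (hv _ (hτ (i+1)))⟩
  have hq : ∀ q, P (i0 + q * (κ+1)) ∧ τ (i0 + q * (κ+1) + 1) = κ := by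
    intro q
    induction q with
    | zero => simpa using ⟨hi0, hTi0⟩
    | succ q ih =>
      have e1 := hτ (i0 + q * (κ+1) + 1)
      have e2 := hcl _ ih.1 ih.2
      rw [ih.2] at e1 e2
      have : i0 + (q+1) * (κ+1) = i0 + q * (κ+1) + 1 + κ := by ring
      rw [this]
      exact ⟨e1, e2⟩
  have hr : ∀ q r, r < κ + 1 → (P (i0 + q * (κ+1) + r) ↔ r = 0) := by
    intro q r hr
    constructor
    · intro h
      by_contra hne
      refine hmin (i0 + q * (κ+1) + 1) (r - 1) (by rw [(hq q).2]; omega) ?_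
      rwa [show i0 + q * (κ+1) + 1 + (r-1) = i0 + q * (κ+1) + r by omega]
    · rintro rfl
      exact (hq q).1
  refine ⟨i0, κ + 1, by omega, fun n hn => ?_⟩
  obtain ⟨j, rfl⟩ := Nat.exists_eq_add_of_le hn
  have hj : j = j / (κ+1) * (κ+1) + j % (κ+1) := (Nat.div_add_mod' j (κ+1)).symm
  have hlt : j % (κ+1) < κ + 1 := Nat.mod_lt _ (by omega)
  generalize j / (κ+1) = q at hj
  generalize j % (κ+1) = r at hj hlt
  subst hj
  rw [show i0 + (q * (κ+1) + r) + (κ+1) = i0 + (q+1) * (κ+1) + r by ring,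
    show i0 + (q * (κ+1) + r) = i0 + q * (κ+1) + r by ring, hr _ _ hlt, hr _ _ hlt]

/-- A decreasing system: period two. -/
theorem seq_evper_anti (x : ℕ → ℚ) (c : ℚ) (h : ∀ i j, x i ≤ x j → x (j+1) ≤ x (i+1)) :
    ∃ N M, 0 < M ∧ ∀ k, N ≤ k → (x (k+M) < c ↔ x k < c) := by
  have h2 : ∀ i j, x i ≤ x j → x (i+2) ≤ x (j+2) := fun i j hij => h _ _ (h _ _ hij)
  have main : ∀ s, ∃ N, ∀ k, N ≤ k → (x (s + 2 * (k+1)) < c ↔ x (s + 2 * k) < c) := by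
    intro s
    rcases le_total (x s) (x (s+2)) with hs | hs
    · have hm : ∀ k, x (s + 2*k) ≤ x (s + 2*(k+1)) := by
        intro k
        induction k with
        | zero => simpa using hs
        | succ k ih => exact h2 _ _ ih
      have hmono : Monotone fun k => x (s + 2*k) := monotone_nat_of_le_succ hm
      by_cases hc : ∃ k, c ≤ x (s + 2*k)
      · obtain ⟨k, hk⟩ := hc
        exact ⟨k, fun j hj => iff_of_false (not_lt.2 (hk.trans (hmono (by omega))))
          (not_lt.2 (hk.trans (hmono hj)))⟩
      · push Not at hc
        exact ⟨0, fun j _ => iff_of_true (hc _) (hc _)⟩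
    · have hm : ∀ k, x (s + 2*(k+1)) ≤ x (s + 2*k) := by
        intro k
        induction k with
        | zero => simpa using hs
        | succ k ih => exact h2 _ _ ih
      have hmono : Antitone fun k => x (s + 2*k) := antitone_nat_of_succ_le hm
      by_cases hc : ∃ k, x (s + 2*k) < c
      · obtain ⟨k, hk⟩ := hc
        exact ⟨k, fun j hj => iff_of_true (lt_of_le_of_lt (hmono (show k ≤ j + 1 by omega)) hk)
          (lt_of_le_of_lt (hmono hj) hk)⟩
      · push Not at hc
        exact ⟨0, fun j _ => iff_of_false (not_lt.2 (hc _)) (not_lt.2 (hc _))⟩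
  obtain ⟨N0, h0⟩ := main 0
  obtain ⟨N1, h1⟩ := main 1
  refine ⟨2 * (N0 + N1) + 2, 2, by norm_num, fun k hk => ?_⟩
  rcases Nat.even_or_odd' k with ⟨j, rfl | rfl⟩
  · have := h0 j (by omega)
    rwa [show 0 + 2 * (j+1) = 2 * j + 2 by ring, show 0 + 2 * j = 2 * j by ring] at this
  · have := h1 j (by omega)
    rwa [show 1 + 2 * (j+1) = 2 * j + 1 + 2 by ring, show 1 + 2 * j = 2 * j + 1 by ring] at this

/-- An absorbing predicate. -/
theorem seq_evper_inv (P : ℕ → Prop) (h : ∀ i, P i → P (i+1)) :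
    ∃ N M, 0 < M ∧ ∀ k, N ≤ k → (P (k+M) ↔ P k) := by
  by_cases hP : ∃ i, P i
  · obtain ⟨i, hi⟩ := hP
    have : ∀ j, P (i+j) := by
      intro j
      induction j with
      | zero => exact hi
      | succ j ih => exact h _ ih
    refine ⟨i, 1, one_pos, fun k hk => ?_⟩
    obtain ⟨j, rfl⟩ := Nat.exists_eq_add_of_le hk
    exact iff_of_true (this (j+1)) (this j)
  · push Not at hP
    exact ⟨0, 1, one_pos, fun k _ => iff_of_false (hP _) (hP _)⟩

/-- Validity of the parameters. -/
structure Good (p : Q7) : Prop where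
  c0 : 0 < p.2.2.2.2.1
  c1 : p.2.2.2.2.1 < 1
  neg : p.1 < 0 ∨ p.2.2.1 < 0
  x0 : 0 ≤ p.2.2.2.2.2.1 ∧ p.2.2.2.2.2.1 < 1
  t : 0 ≤ p.2.2.2.2.2.2 ∧ p.2.2.2.2.2.2 < 1
  maps : ∀ x, 0 ≤ x → x < 1 → 0 ≤ fm p x ∧ fm p x < 1
  inj : ∀ x y, 0 ≤ x → x < 1 → 0 ≤ y → y < 1 → fm p x = fm p y → x = y

theorem fm_lt {p : Q7} {u : ℚ} (h : u < p.2.2.2.2.1) : fm p u = p.1 * u + p.2.1 := br_lt h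
theorem fm_ge {p : Q7} {u : ℚ} (h : p.2.2.2.2.1 ≤ u) : fm p u = p.2.2.1 * u + p.2.2.2.1 := br_ge h

theorem Good.sep {p : Q7} (g : Good p) :
    (∀ x y, 0 ≤ x → x < p.2.2.2.2.1 → p.2.2.2.2.1 ≤ y → y < 1 → fm p x < fm p y) ∨
    (∀ x y, 0 ≤ x → x < p.2.2.2.2.1 → p.2.2.2.2.1 ≤ y → y < 1 → fm p y < fm p x) := by
  have hc0 := g.c0
  have hc1 := g.c1
  by_contra hcon
  push Not at hcon
  obtain ⟨⟨x, y, hx0, hxc, hyc, hy1, hxy⟩, ⟨x', y', hx0', hxc', hyc', hy1', hxy'⟩⟩ := hcon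
  rw [fm_lt hxc, fm_ge hyc] at hxy
  rw [fm_lt hxc', fm_ge hyc'] at hxy'
  obtain ⟨s, hs0, hs1, hs⟩ : ∃ s : ℚ, 0 ≤ s ∧ s ≤ 1 ∧
      (1 - s) * ((p.1 * x + p.2.1) - (p.2.2.1 * y + p.2.2.2.1)) +
        s * ((p.1 * x' + p.2.1) - (p.2.2.1 * y' + p.2.2.2.1)) = 0 := by
    generalize hA : (p.1 * x + p.2.1) - (p.2.2.1 * y + p.2.2.2.1) = A
    generalize hB : (p.1 * x' + p.2.1) - (p.2.2.1 * y' + p.2.2.2.1) = B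
    have hA0 : 0 ≤ A := by linarith
    have hB0 : B ≤ 0 := by linarith
    rcases hA0.eq_or_lt with h | h
    · exact ⟨0, le_rfl, zero_le_one, by rw [← h]; ring⟩
    · have hd : 0 < A - B := by linarith
      refine ⟨A / (A - B), div_nonneg hA0 hd.le, (div_le_one hd).2 (by linarith), ?_⟩
      field_simp
      ring
  have hX0 : 0 ≤ (1-s) * x + s * x' := by nlinarith
  have hXc : (1-s) * x + s * x' < p.2.2.2.2.1 := by
    rcases hs0.eq_or_lt with h | h
    · rw [← h]; linarith
    · nlinarith
  have hYc : p.2.2.2.2.1 ≤ (1-s) * y + s * y' := by nlinarith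
  have hY1 : (1-s) * y + s * y' < 1 := by
    rcases hs0.eq_or_lt with h | h
    · rw [← h]; linarith
    · nlinarith
  have := g.inj ((1-s) * x + s * x') ((1-s) * y + s * y') hX0 (by linarith) (by linarith) hY1
    (by rw [fm_lt hXc, fm_ge hYc]; linarith)
  linarith

theorem Good.orbit {p : Q7} (g : Good p) (n : ℕ) :
    0 ≤ (fm p)^[n] p.2.2.2.2.2.1 ∧ (fm p)^[n] p.2.2.2.2.2.1 < 1 := by
  induction n with
  | zero => exact g.x0
  | succ n ih => rw [Function.iterate_succ_apply']; exact g.maps _ ih.1 ih.2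

theorem Good.evper {p : Q7} (g : Good p) : ∃ N M, 0 < M ∧ ∀ k, N ≤ k →
    ((fm p)^[k+M] p.2.2.2.2.2.1 < p.2.2.2.2.1 ↔ (fm p)^[k] p.2.2.2.2.2.1 < p.2.2.2.2.1) := by
  have horb := g.orbit
  obtain ⟨x, hx⟩ : ∃ x : ℕ → ℚ, x = fun n => (fm p)^[n] p.2.2.2.2.2.1 := ⟨_, rfl⟩
  have hx' : ∀ n, (fm p)^[n] p.2.2.2.2.2.1 = x n := fun n => by rw [hx]
  have hs : ∀ n, x (n+1) = fm p (x n) := fun n => by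
    rw [← hx', ← hx', Function.iterate_succ_apply']
  simp only [hx'] at horb ⊢
  clear hx hx'
  have hlt : ∀ i, x i < p.2.2.2.2.1 → x (i+1) = p.1 * x i + p.2.1 := fun i h => by
    rw [hs, fm_lt h]
  have hge : ∀ i, ¬ (x i < p.2.2.2.2.1) → x (i+1) = p.2.2.1 * x i + p.2.2.2.1 := fun i h => by
    rw [hs, fm_ge (not_lt.1 h)]
  rcases g.sep with hsep | hsep
  · by_cases hy : ∃ y, p.2.2.2.2.1 ≤ y ∧ y < 1 ∧ fm p y < p.2.2.2.2.1
    · obtain ⟨y, hy1, hy2, hy3⟩ := hy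
      refine seq_evper_inv (fun k => x k < p.2.2.2.2.1) fun i hi => ?_
      show x (i+1) < _
      rw [hs]
      exact (hsep _ y (horb i).1 hi hy1 hy2).trans hy3
    · push Not at hy
      obtain ⟨N, M, hM, h⟩ := seq_evper_inv (fun k => p.2.2.2.2.1 ≤ x k) (fun i hi => by
        show _ ≤ x (i+1)
        rw [hs]
        exact hy _ hi (horb i).2)
      exact ⟨N, M, hM, fun k hk => by rw [← not_le, ← not_le, h k hk]⟩
  · have hsep' : ∀ i j, x i < p.2.2.2.2.1 → ¬ (x j < p.2.2.2.2.1) → x (j+1) < x (i+1) := by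
      intro i j hi hj
      rw [hs, hs]
      exact hsep _ _ (horb i).1 hi (not_lt.1 hj) (horb j).2
    rcases le_or_gt p.1 0 with ha1 | ha1
    · rcases le_or_gt p.2.2.1 0 with ha2 | ha2
      · apply seq_evper_anti
        intro i j hij
        by_cases hi : x i < p.2.2.2.2.1
        · by_cases hj : x j < p.2.2.2.2.1
          · rw [hlt i hi, hlt j hj]; nlinarith
          · exact (hsep' i j hi hj).le
        · have hj : ¬ (x j < p.2.2.2.2.1) := fun h => hi (lt_of_le_of_lt hij h)
          rw [hge i hi, hge j hj]; nlinarith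
      · apply seq_evper x (fun k => x k < p.2.2.2.2.1)
        · intro i j hi hj; exact lt_of_lt_of_le hi (not_lt.1 hj)
        · intro i j hi hj hij; rw [hlt i hi, hlt j hj]; nlinarith
        · intro i j hi hj hij; rw [hge i hi, hge j hj]; nlinarith
        · exact hsep'
    · have ha2 : p.2.2.1 < 0 := g.neg.resolve_left (not_lt.2 ha1.le)
      obtain ⟨N, M, hM, h⟩ := seq_evper (fun k => OrderDual.toDual (x k)) (fun k => ¬ (x k < p.2.2.2.2.1))
        (fun i j hi hj => OrderDual.toDual_lt_toDual.2 (lt_of_lt_of_le (not_not.1 hj) (not_lt.1 hi)))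
        (fun i j hi hj hij => by
          rw [OrderDual.toDual_le_toDual] at hij ⊢
          rw [hge i hi, hge j hj]; nlinarith)
        (fun i j hi hj hij => by
          rw [OrderDual.toDual_le_toDual] at hij ⊢
          rw [hlt i (not_not.1 hi), hlt j (not_not.1 hj)]; nlinarith)
        (fun i j hi hj => by
          rw [OrderDual.toDual_lt_toDual]
          exact hsep' j i (not_not.1 hj) hi)
      exact ⟨N, M, hM, fun k hk => not_iff_not.1 (h k hk)⟩

/-- Composition of the branches selected by the sequence `s`. -/
def phi (p : Q7) (s : ℕ → ℚ) : ℕ → ℚ → ℚ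
  | 0, v => v
  | i + 1, v => br p (s i) (phi p s i v)

theorem phi_affine (p : Q7) (s : ℕ → ℚ) (i : ℕ) : ∃ A B, ∀ v, phi p s i v = A * v + B := by
  induction i with
  | zero => exact ⟨1, 0, fun v => by simp [phi]⟩
  | succ i ih =>
    obtain ⟨A, B, h⟩ := ih
    by_cases hs : s i < p.2.2.2.2.1
    · exact ⟨p.1 * A, p.1 * B + p.2.1, fun v => by
        simp only [phi]; rw [br_lt hs, h]; ring⟩
    · exact ⟨p.2.2.1 * A, p.2.2.1 * B + p.2.2.2.1, fun v => by
        simp only [phi]; rw [br_ge (not_lt.1 hs), h]; ring⟩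

theorem phi_congr (p : Q7) (s r : ℕ → ℚ)
    (h : ∀ i, s i < p.2.2.2.2.1 ↔ r i < p.2.2.2.2.1) (i : ℕ) (v : ℚ) :
    phi p s i v = phi p r i v := by
  induction i with
  | zero => rfl
  | succ i ih => simp only [phi, br, ih, h i]

theorem phi_add (p : Q7) (s : ℕ → ℚ) (k i : ℕ) (v : ℚ) :
    phi p s (k + i) v = phi p (fun j => s (k + j)) i (phi p s k v) := by
  induction i with
  | zero => rfl
  | succ i ih => rw [← add_assoc]; simp only [phi, ih]

theorem phi_orbit (p : Q7) (s : ℕ → ℚ) (hs : ∀ i, s (i + 1) = fm p (s i)) (i : ℕ) :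
    phi p s i (s 0) = s i := by
  induction i with
  | zero => rfl
  | succ i ih => simp only [phi, ih, hs, fm]

theorem contraction (y : ℕ → ℚ) (D E : ℚ) (hD : 0 ≤ D) (hy : ∀ j, y (j + 1) = D * y j + E)
    (hb : ∀ j, 0 ≤ y j ∧ y j < 1) (hne : ∀ j, y (j + 1) ≠ y j) : 0 < D ∧ D < 1 := by
  constructor
  · rcases hD.lt_or_eq with h | h
    · exact h
    · exact absurd (by rw [hy 1, hy 0, ← h]; ring) (hne 1)
  · by_contra h1
    push Not at h1
    have key : ∀ j : ℕ, ∃ S : ℚ, (j : ℚ) ≤ S ∧ y j - y 0 = (y 1 - y 0) * S := by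
      intro j
      induction j with
      | zero => exact ⟨0, by simp, by simp⟩
      | succ j ih =>
        obtain ⟨S, h2, h3⟩ := ih
        have hj : (0 : ℚ) ≤ j := by positivity
        refine ⟨D * S + 1, ?_, ?_⟩
        · push_cast; nlinarith
        · have e := hy j
          have e0 := hy 0
          simp only [zero_add] at e0
          rw [e]
          linear_combination D * h3 - e0
    have hd : 0 < |y 1 - y 0| := abs_pos.2 (sub_ne_zero.2 (hne 0))
    obtain ⟨j, hj⟩ := exists_nat_gt (1 / |y 1 - y 0|)
    obtain ⟨S, h2, h3⟩ := key j
    have h4 : |y j - y 0| < 1 := by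
      rw [abs_lt]; have := hb j; have := hb 0; constructor <;> linarith
    rw [h3, abs_mul] at h4
    have h5 : 1 / |y 1 - y 0| < |S| := lt_of_lt_of_le hj (h2.trans (le_abs_self S))
    rw [div_lt_iff₀ hd] at h5
    linarith

theorem runv_ini (p : Q7) (hnr : ∀ k, (fm p)^[k] p.2.2.2.2.2.1 ≠ p.2.2.2.2.2.2) (n : ℕ) :
    runv p (ini p) n = ((fm p)^[n] p.2.2.2.2.2.1, (fm p)^[n] p.2.2.2.2.2.1, true) := by
  induction n with
  | zero => rfl
  | succ n ih =>
    have h1 : okc p ((fm p)^[n] p.2.2.2.2.2.1) ((fm p)^[n] p.2.2.2.2.2.1) = true := by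
      rw [okc_iff]; exact ⟨le_of_lt, id⟩
    have h2 : inSeg p.2.2.2.2.2.2 ((fm p)^[n] p.2.2.2.2.2.1) ((fm p)^[n] p.2.2.2.2.2.1) = false := by
      rw [← Bool.not_eq_true, inSeg_iff]
      rintro (h | h | h)
      · exact hnr n h.symm
      · exact lt_asymm h.1 h.2
      · exact lt_asymm h.1 h.2
    simp only [runv, ih, stp, h1, h2, Function.iterate_succ_apply', fm, Bool.and_self, Bool.not_false]

theorem runv_mid (p : Q7) (s : ℕ → ℚ) (hs : ∀ i, s (i + 1) = fm p (s i)) (q : ℚ) (L : ℕ)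
    (h : ∀ i < L, okc p (s i) (phi p s i q) = true ∧
      inSeg p.2.2.2.2.2.2 (s i) (phi p s i q) = false) (i : ℕ) (hi : i ≤ L) :
    runv p (s 0, q, true) i = (s i, phi p s i q, true) := by
  induction i with
  | zero => rfl
  | succ i ih =>
    obtain ⟨h1, h2⟩ := h i (by omega)
    simp only [runv, ih (by omega), stp, h1, h2, hs, fm, phi, Bool.and_self, Bool.not_false]

/-- Sufficient conditions for a nonreachability certificate. -/
theorem nonreach_of (p : Q7) (hnr : ∀ k, (fm p)^[k] p.2.2.2.2.2.1 ≠ p.2.2.2.2.2.2)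
    (n L : ℕ) (hL : 0 < L) (q : ℚ) (s : ℕ → ℚ)
    (hs : s = fun i => (fm p)^[n + i] p.2.2.2.2.2.1)
    (h : ∀ i < L, okc p (s i) (phi p s i q) = true ∧
      inSeg p.2.2.2.2.2.2 (s i) (phi p s i q) = false)
    (hq : phi p s L q = q) (hseg : inSeg (s L) (s 0) q = true) :
    ∃ n m q, nonreachC p n m q = true := by
  refine ⟨n, L - 1, q, ?_⟩
  have hs1 : ∀ i, s (i + 1) = fm p (s i) := by
    intro i; rw [hs]; simp only [← add_assoc]; rw [Function.iterate_succ_apply']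
  have e0 : (fm p)^[n] p.2.2.2.2.2.1 = s 0 := by rw [hs]; rfl
  have e1 : mid p n q = (s 0, q, true) := by
    simp only [mid, runv_ini p hnr, e0]
  have e2 : L - 1 + 1 = L := by omega
  simp only [nonreachC, e1, e2, runv_mid p s hs1 q L h L le_rfl, hq, runv_ini p hnr, e0, hseg]
  simp

theorem Good.complete {p : Q7} (g : Good p)
    (hnr : ∀ k, (fm p)^[k] p.2.2.2.2.2.1 ≠ p.2.2.2.2.2.2) :
    ∃ n m q, nonreachC p n m q = true := by
  obtain ⟨N, M, hM, hper⟩ := g.evper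
  set s : ℕ → ℚ := fun i => (fm p)^[N + i] p.2.2.2.2.2.1 with hsdef
  have hs1 : ∀ i, s (i + 1) = fm p (s i) := by
    intro i; rw [hsdef]; simp only [← add_assoc]; rw [Function.iterate_succ_apply']
  have hside : ∀ j i, s (M * j + i) < p.2.2.2.2.1 ↔ s i < p.2.2.2.2.1 := by
    intro j
    induction j with
    | zero => intro i; simp
    | succ j ih =>
      intro i
      rw [← ih i]
      have := hper (N + (M * j + i)) (by omega)
      simp only [hsdef]
      rw [← this]
      have e : N + (M * (j + 1) + i) = N + (M * j + i) + M := by ring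
      rw [e]
  have hphi : ∀ j i v, phi p (fun k => s (M * j + k)) i v = phi p s i v :=
    fun j i v => phi_congr p _ _ (hside j) i v
  have horb : ∀ j i, s (M * j + i) = phi p s i (s (M * j)) := by
    intro j i
    rw [← hphi j]
    exact (phi_orbit p (fun k => s (M * j + k)) (fun i => hs1 _) i).symm
  obtain ⟨A, B, hAB⟩ := phi_affine p s M
  have hDE : ∀ v, phi p s (2 * M) v = (A * A) * v + (A * B + B) := by
    intro v
    rw [two_mul, phi_add]
    have := hphi 1 M (phi p s M v)
    rw [mul_one] at this
    rw [this, hAB, hAB]; ring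
  set y : ℕ → ℚ := fun j => s (M * (2 * j)) with hydef
  have hy : ∀ j, y (j + 1) = (A * A) * y j + (A * B + B) := by
    intro j
    rw [← hDE, hydef]; simp only
    rw [← horb]; congr 1; ring
  have hb : ∀ j, 0 ≤ y j ∧ y j < 1 := fun j => g.orbit _
  have hsn : ∀ j, (fun k => s (M * (2 * j) + k)) =
      fun i => (fm p)^[N + M * (2 * j) + i] p.2.2.2.2.2.1 := by
    intro j; funext k; simp only [hsdef, add_assoc]
  have hnrs : ∀ i, s i ≠ p.2.2.2.2.2.2 := fun i => hnr _
  by_cases hfix : ∃ j, y (j + 1) = y j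
  · obtain ⟨j, hj⟩ := hfix
    refine nonreach_of p hnr (N + M * (2 * j)) (2 * M) (by omega) (y j)
      (fun k => s (M * (2 * j) + k)) (hsn j) ?_ ?_ ?_
    · intro i _
      have e : phi p (fun k => s (M * (2 * j) + k)) i (y j) = s (M * (2 * j) + i) := by
        rw [hphi, horb]
      rw [e]
      constructor
      · rw [okc_iff]; exact ⟨le_of_lt, id⟩
      · rw [← Bool.not_eq_true, inSeg_iff]
        rintro (h | h | h)
        · exact hnrs _ h.symm
        · exact lt_asymm h.1 h.2
        · exact lt_asymm h.1 h.2
    · rw [hphi, hDE, ← hy, hj]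
    · rw [inSeg_iff]; left
      have e : s (M * (2 * j) + 2 * M) = y (j + 1) := by simp only [hydef]; congr 1; ring
      simp only [e, hj]; rfl
  · push Not at hfix
    obtain ⟨hD0, hD1⟩ := contraction y _ _ (mul_self_nonneg A) hy hb hfix
    set D := A * A with hDdef
    set q : ℚ := (A * B + B) / (1 - D) with hqdef
    have hD' : (1 - D) ≠ 0 := by linarith
    have hq : D * q + (A * B + B) = q := by rw [hqdef]; field_simp; ring
    have hyq : ∀ j, y j = q + D ^ j * (y 0 - q) := by
      intro j
      induction j with
      | zero => simp
      | succ j ih => rw [hy, ih, pow_succ]; linear_combination hq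
    have hlim : Filter.Tendsto y Filter.atTop (nhds q) := by
      have h0 := tendsto_pow_atTop_nhds_zero_of_lt_one hD0.le hD1
      have h1 := (h0.mul_const (y 0 - q)).const_add q
      rw [zero_mul, add_zero] at h1
      exact h1.congr fun j => (hyq j).symm
    have hlimi : ∀ i, Filter.Tendsto (fun j => s (M * (2 * j) + i)) Filter.atTop
        (nhds (phi p s i q)) := by
      intro i
      obtain ⟨a, b, hab⟩ := phi_affine p s i
      have h1 := (hlim.const_mul a).add_const b
      rw [hab q]
      exact h1.congr fun j => by rw [horb, hab]
    have hok : ∀ i j, okc p (s (M * (2 * j) + i)) (phi p s i q) = true := by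
      intro i j
      rw [okc_iff]
      constructor
      · intro h
        rw [hside] at h
        exact le_of_tendsto (hlimi i) (Filter.Eventually.of_forall fun k => ((hside _ _).2 h).le)
      · intro h
        rw [← not_lt, hside] at h
        exact ge_of_tendsto (hlimi i)
          (Filter.Eventually.of_forall fun k => not_lt.1 fun h' => h ((hside _ _).1 h'))
    have hev : ∀ i, ∀ᶠ j in Filter.atTop,
        inSeg p.2.2.2.2.2.2 (s (M * (2 * j) + i)) (phi p s i q) = false := by
      intro i
      rcases lt_trichotomy (phi p s i q) p.2.2.2.2.2.2 with h | h | h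
      · filter_upwards [(hlimi i).eventually_lt_const h] with j hj
        rw [← Bool.not_eq_true, inSeg_iff]
        rintro (h1 | h1 | h1)
        · exact hnrs _ h1.symm
        · exact lt_asymm h h1.2
        · exact lt_asymm hj h1.2
      · refine Filter.Eventually.of_forall fun j => ?_
        rw [← Bool.not_eq_true, inSeg_iff, h]
        rintro (h1 | h1 | h1)
        · exact hnrs _ h1.symm
        · exact lt_irrefl _ h1.2
        · exact lt_irrefl _ h1.1
      · filter_upwards [(hlimi i).eventually_const_lt h] with j hj
        rw [← Bool.not_eq_true, inSeg_iff]
        rintro (h1 | h1 | h1)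
        · exact hnrs _ h1.symm
        · exact lt_asymm hj h1.1
        · exact lt_asymm h h1.1
    have hall : ∀ᶠ j in Filter.atTop, ∀ i ∈ Finset.range (2 * M),
        inSeg p.2.2.2.2.2.2 (s (M * (2 * j) + i)) (phi p s i q) = false :=
      (Filter.eventually_all_finset _).2 fun i _ => hev i
    obtain ⟨j, hj⟩ := hall.exists
    refine nonreach_of p hnr (N + M * (2 * j)) (2 * M) (by omega) q
      (fun k => s (M * (2 * j) + k)) (hsn j) ?_ ?_ ?_
    · intro i hi
      rw [hphi]
      exact ⟨hok i j, hj i (Finset.mem_range.2 hi)⟩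
    · rw [hphi, hDE, hq]
    · have e : s (M * (2 * j) + 2 * M) = y (j + 1) := by simp only [hydef]; congr 1; ring
      have e2 : s (M * (2 * j) + 0) = y j := rfl
      simp only [e, e2]
      rw [inSeg_iff, hy]
      rcases lt_trichotomy (y j) q with h | h | h
      · right; left; constructor <;> nlinarith
      · left; rw [h]; exact hq
      · right; right; constructor <;> nlinarith

theorem inI_iff (x : ℚ) : inI x = true ↔ 0 ≤ x ∧ x < 1 := by simp [inI]

theorem goodC_iff (p : Q7) (x y : ℚ) : goodC p x y = true ↔
    (0 < p.2.2.2.2.1 ∧ p.2.2.2.2.1 < 1) ∧ (p.1 < 0 ∨ p.2.2.1 < 0) ∧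
    ((0 ≤ p.2.2.2.2.2.1 ∧ p.2.2.2.2.2.1 < 1) ∧ (0 ≤ p.2.2.2.2.2.2 ∧ p.2.2.2.2.2.2 < 1)) ∧
    ((0 ≤ x ∧ x < 1) → (0 ≤ fm p x ∧ fm p x < 1)) ∧
    ((0 ≤ x ∧ x < 1) → (0 ≤ y ∧ y < 1) → fm p x = fm p y → x = y) := by
  simp only [goodC, Bool.and_eq_true, Bool.or_eq_true, Bool.not_eq_true', decide_eq_true_eq,
    decide_eq_false_iff_not, ← inI_iff, fm]
  simp only [← Bool.not_eq_true]
  tauto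

theorem all_cert (p : Q7) : ∃ w, certC p w = true := by
  by_cases h : ∀ x y, goodC p x y = true
  · have g : Good p := by
      simp only [goodC_iff] at h
      obtain ⟨h1, h2, h3, -⟩ := h 0 0
      exact ⟨h1.1, h1.2, h2, h3.1, h3.2, fun x hx hx' => (h x x).2.2.2.1 ⟨hx, hx'⟩,
        fun x y => by have := (h x y).2.2.2.2; tauto⟩
    by_cases hr : ∃ k, (fm p)^[k] p.2.2.2.2.2.1 = p.2.2.2.2.2.2
    · obtain ⟨k, hk⟩ := hr
      exact ⟨(k, 0, 0, 0, 0), by simp [certC, (reachC_iff p k).2 hk]⟩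
    · push Not at hr
      obtain ⟨n, m, q, hn⟩ := g.complete hr
      exact ⟨(n, m, q, 0, 0), by simp [certC, hn]⟩
  · push Not at h
    obtain ⟨x, y, hxy⟩ := h
    exact ⟨(0, 0, 0, x, y), by simp [certC, hxy]⟩

end PamAux


/-- Reachability is decidable for injective two-interval PAM with at least one
negative slope. -/
theorem pam_reachability_decidable_some_neg_slope :
    ∃ F : ℚ × ℚ × ℚ × ℚ × ℚ × ℚ × ℚ → Bool, Computable F ∧
      ∀ a1 b1 a2 b2 c x0 t : ℚ,
        0 < c → c < 1 →
        (∀ x ∈ Set.Ico (0 : ℚ) 1, pam2 a1 b1 a2 b2 c x ∈ Set.Ico (0 : ℚ) 1) →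
        Set.InjOn (pam2 a1 b1 a2 b2 c) (Set.Ico (0 : ℚ) 1) →
        (a1 < 0 ∨ a2 < 0) →
        x0 ∈ Set.Ico (0 : ℚ) 1 → t ∈ Set.Ico (0 : ℚ) 1 →
        (F (a1, b1, a2, b2, c, x0, t) = true ↔
          ∃ n : ℕ, (pam2 a1 b1 a2 b2 c)^[n] x0 = t) := by
  obtain ⟨F, hF, h⟩ := PamAux.exists_decider PamAux.all_cert
  refine ⟨F, hF, ?_⟩
  intro a1 b1 a2 b2 c x0 t hc0 hc1 hmaps hinj hneg hx0 ht
  have hfm : ∀ x ∈ Set.Ico (0 : ℚ) 1,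
      pam2 a1 b1 a2 b2 c x = PamAux.fm (a1, b1, a2, b2, c, x0, t) x := by
    intro x hx
    by_cases hxc : x < c
    · rw [PamAux.fm, PamAux.br_lt hxc]
      simp only [pam2]
      rw [if_pos ⟨hx.1, hxc⟩]
    · rw [PamAux.fm, PamAux.br_ge (not_lt.1 hxc)]
      simp only [pam2]
      rw [if_neg (fun h => hxc h.2), if_pos ⟨not_lt.1 hxc, hx.2⟩]
  have hit : ∀ n, (pam2 a1 b1 a2 b2 c)^[n] x0 ∈ Set.Ico (0 : ℚ) 1 ∧
      (pam2 a1 b1 a2 b2 c)^[n] x0 = (PamAux.fm (a1, b1, a2, b2, c, x0, t))^[n] x0 := by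
    intro n
    induction n with
    | zero => exact ⟨hx0, rfl⟩
    | succ n ih =>
      rw [Function.iterate_succ_apply', Function.iterate_succ_apply', ← ih.2]
      exact ⟨hmaps _ ih.1, hfm _ ih.1⟩
  have hgood : ∀ x y, PamAux.goodC (a1, b1, a2, b2, c, x0, t) x y = true := by
    intro x y
    rw [PamAux.goodC_iff]
    refine ⟨⟨hc0, hc1⟩, hneg, ⟨hx0, ht⟩, ?_, ?_⟩
    · intro hx
      rw [← hfm x hx]
      exact hmaps x hx
    · intro hx hy hxy
      rw [← hfm x hx, ← hfm y hy] at hxy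
      exact hinj hx hy hxy
  obtain ⟨w, hw, hFw⟩ := h (a1, b1, a2, b2, c, x0, t)
  rw [hFw, PamAux.reachC_iff]
  constructor
  · intro hr
    exact ⟨w.1, by rw [(hit _).2]; exact hr⟩
  · rintro ⟨n, hn⟩
    rw [(hit n).2] at hn
    rw [PamAux.certC, hgood] at hw
    simp only [Bool.not_true, Bool.false_or, Bool.or_eq_true] at hw
    rcases hw with hw | hw
    · exact (PamAux.reachC_iff _ _).1 hw
    · exact absurd hn (PamAux.nonreachC_sound _ _ _ _ hw n)
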